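/- For a matrix polynomial Φ ∈ Mat_r(ℂ[z]), multiplication by Φ preserves M_Λ (i.e. Φ·s ∈ M_Λ for every s ∈ M_Λ) if and only if Φ(P_1) = Λ_i Φ(P_i) Λ_i^{-1} for every i = 2, …, N. -/

import Mathlib

open Polynomial Matrix

noncomputable section

/-- Evaluation of polynomials commutes with the matrix-vector product. -/
theorem eval_mulVec {m n R : Type*} [Fintype n] [CommSemiring R]
    (Φ : Matrix m n R[X]) (s : n → R[X]) (a : R) :
    (fun j => ((Φ *ᵥ s) j).eval a) = Φ.map (eval a) *ᵥ fun j => (s j).eval a := by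
  ext j
  simp [mulVec, dotProduct, eval_finsetSum]

/-- A vector-valued polynomial may take arbitrary values at finitely many distinct points. -/
theorem exists_eval_eq {ι m F : Type*} [Fintype ι] [Field F] {P : ι → F}
    (hP : Function.Injective P) (w : ι → m → F) :
    ∃ s : m → F[X], ∀ i, (fun j => (s j).eval (P i)) = w i := by
  classical
  refine ⟨fun j => Lagrange.interpolate Finset.univ P fun i => w i j, fun i => ?_⟩
  ext j
  exact Lagrange.eval_interpolate_at_node _ hP.injOn (Finset.mem_univ i)

/-- Let `P 0, …, P (n+1)` be `N = n + 2 ≥ 2` pairwise distinct points,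
`Λ i` invertible matrices for `i ≠ 0`, and `M_Λ` the set of vector-valued polynomials
`s` with `s (P 0) = Λ i *ᵥ s (P i)` for all `i ≠ 0`.  A matrix polynomial `Φ`
preserves `M_Λ` under multiplication if and only if
`Φ (P 0) = Λ i * Φ (P i) * (Λ i)⁻¹` for every `i ≠ 0`. -/
theorem statement3 (n r : ℕ) (hr : 1 ≤ r) (P : Fin (n + 2) → ℂ)
    (hP : Function.Injective P)
    (Λ : Fin (n + 2) → Matrix (Fin r) (Fin r) ℂ)
    (hΛ : ∀ i, i ≠ 0 → IsUnit (Λ i))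
    (Φ : Matrix (Fin r) (Fin r) (Polynomial ℂ)) :
    (∀ s : Fin r → Polynomial ℂ,
        (∀ i, i ≠ 0 → (fun j => (s j).eval (P 0)) = (Λ i) *ᵥ fun j => (s j).eval (P i)) →
        (∀ i, i ≠ 0 → (fun j => ((Φ *ᵥ s) j).eval (P 0))
            = (Λ i) *ᵥ fun j => ((Φ *ᵥ s) j).eval (P i)))
      ↔ (∀ i, i ≠ 0 → Φ.map (eval (P 0)) = Λ i * Φ.map (eval (P i)) * (Λ i)⁻¹) := by
  simp only [eval_mulVec]
  constructor
  · intro h i hi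
    refine Matrix.ext_of_mulVec_single fun k => ?_
    set v : Fin r → ℂ := Pi.single k 1
    obtain ⟨s, hs⟩ := exists_eval_eq hP fun i => if i = 0 then v else (Λ i)⁻¹ *ᵥ v
    have key := h s (fun l hl => by
      rw [hs, hs, if_pos rfl, if_neg hl, mulVec_mulVec,
        mul_nonsing_inv _ ((isUnit_iff_isUnit_det _).1 (hΛ l hl)), one_mulVec]) i hi
    rw [hs, hs, if_pos rfl, if_neg hi] at key
    rw [key, mulVec_mulVec, mulVec_mulVec, Matrix.mul_assoc]
  · intro h s hs i hi
    have hdet := (isUnit_iff_isUnit_det _).1 (hΛ i hi)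
    rw [h i hi, hs i hi, mulVec_mulVec, mulVec_mulVec, Matrix.mul_assoc _ _ (Λ i),
      nonsing_inv_mul _ hdet, Matrix.mul_one]

end
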